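/- arXiv:2411.16873 — 7 statements merged into one kernel-verified Lean document; each statement's English description precedes it below -/
import Mathlib

section
/- Fix m ≥ 2, n ≥ 1, a mode index a ∈ {0,…,m−1}, a natural number x, and q with q + x ≤ n (and q = 0 if a = 0). Then the set of lattice paths λ ∈ 𝓛(m−1,n) satisfying λ_{a−1} = q (with λ_{−1} = 0) and n^λ_a = x equals the Young-order interval [η^q, ε^q] = {λ : η^q ≤ λ ≤ ε^q}, where ε^q = (q,…,q, q+x, n,…,n) with a copies of q followed by q+x and then m−a−1 copies of n, and η^q = (0,…,0, q, q+x,…,q+x, n) with a−1 copies of 0 followed by q, then m−a−1 copies of q+x, then n (for a > 0), and η^0 = (x, x,…,x, n) for a = 0. -/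
/-- A lattice path in height representation, on `m` points (rectangle `(m-1, H)`):
a nondecreasing sequence bounded by `H` whose last component is `H`. -/
def IsLP (m H : ℕ) (l : Fin m → ℕ) : Prop :=
  Monotone l ∧ (∀ a, l a ≤ H) ∧ ∀ h : 0 < m, l ⟨m - 1, Nat.sub_lt h Nat.one_pos⟩ = H

/-- `λ_{a-1}`, with the convention `λ_{-1} = 0`. -/
def prevH {m : ℕ} (l : Fin m → ℕ) (a : Fin m) : ℕ :=
  if h : (a : ℕ) = 0 then 0 else l ⟨(a : ℕ) - 1, by have := a.isLt; omega⟩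

/-- The step representation component `n^λ_a = λ_a - λ_{a-1}`. -/
def stepAt {m : ℕ} (l : Fin m → ℕ) (a : Fin m) : ℕ := l a - prevH l a

/-- Helper top path `ε^q = (q,…,q, q+x, n,…,n)` (`a` copies of `q`, then `q+x`, then `n`s). -/
def eps (W n a x q : ℕ) : Fin (W + 1) → ℕ := fun c =>
  if (c : ℕ) < a then q else if (c : ℕ) = a then q + x else n

/-- Helper bottom path `η^q = (0,…,0, q, q+x,…,q+x, n)` (`a-1` copies of `0`, `q` at index `a-1`,
then `q+x` up to index `W-1`, then `n` at index `W`); for `a = 0` this is `(q+x,…,q+x,n)`. -/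
def eta (W n a x q : ℕ) : Fin (W + 1) → ℕ := fun c =>
  if (c : ℕ) + 1 < a then 0
  else if (c : ℕ) + 1 = a then q
  else if (c : ℕ) < W then q + x else n

/-- Contraction `C_a^x`: delete component `a` of the step representation; in height
representation `(C_a^x l)_b = l_b` for `b < a` and `(C_a^x l)_b = l_{b+1} - x` for `b ≥ a`. -/
def contra {m : ℕ} (x a : ℕ) (l : Fin m → ℕ) : Fin (m - 1) → ℕ := fun b =>
  if (b : ℕ) < a then l ⟨b, by have := b.isLt; omega⟩
  else l ⟨(b : ℕ) + 1, by have := b.isLt; omega⟩ - x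

/-- For `m = W+1 ≥ 2`, `n ≥ 1`, a mode `a`, `x`, and `q` with `q + x ≤ n`
(and `q = 0` if `a = 0`), the set of lattice paths `λ ∈ 𝓛(W,n)` with `λ_{a-1} = q` and
`n^λ_a = x` is exactly the Young-order interval `[η^q, ε^q]` inside `𝓛(W,n)`. -/
theorem stmt4 (W n : ℕ) (hW : 1 ≤ W) (hn : 1 ≤ n) (a : Fin (W + 1)) (x q : ℕ)
    (hqx : q + x ≤ n) (ha0 : (a : ℕ) = 0 → q = 0) :
    {l : Fin (W + 1) → ℕ | IsLP (W + 1) n l ∧ prevH l a = q ∧ stepAt l a = x}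
      = {l : Fin (W + 1) → ℕ | IsLP (W + 1) n l ∧
          eta W n a x q ≤ l ∧ l ≤ eps W n a x q} := by
  ext l
  simp only [Set.mem_ofPred_eq]
  refine and_congr_right fun hl => ?_
  obtain ⟨hm, hb, hlast⟩ := hl
  have hlast : ∀ c : Fin (W + 1), (c : ℕ) = W → l c = n := by
    intro c hc
    have h := hlast (Nat.succ_pos W)
    rw [← h]
    congr 1
    exact Fin.ext (by simpa using hc)
  have hmono : ∀ c d : Fin (W + 1), (c : ℕ) ≤ d → l c ≤ l d := fun c d h => hm h
  have haW := a.isLt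
  unfold stepAt prevH
  by_cases h0 : (a : ℕ) = 0
  · have hq := ha0 h0
    rw [dif_pos h0]
    constructor
    · rintro ⟨-, hx⟩
      constructor
      · intro c
        have h1 := hmono a c (by omega)
        have h2 := hlast c
        have h3 := c.isLt
        simp only [eta]
        split_ifs <;> omega
      · intro c
        have h1 := hb c
        have h2 := hmono c a
        simp only [eps]
        split_ifs <;> omega
    · rintro ⟨h1, h2⟩
      have h1 := h1 a
      have h2 := h2 a
      simp only [eta, eps] at h1 h2
      split_ifs at h1 h2 <;> omega
  · rw [dif_neg h0]
    have hp : (a : ℕ) - 1 < W + 1 := by omega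
    obtain ⟨p, hpp⟩ : ∃ p : Fin (W + 1), p = ⟨(a : ℕ) - 1, hp⟩ := ⟨_, rfl⟩
    have hpv : (p : ℕ) = (a : ℕ) - 1 := by rw [hpp]
    rw [← hpp]
    have hpa := hmono p a (by omega)
    constructor
    · rintro ⟨hq, hx⟩
      constructor
      · intro c
        have h1 := hmono a c
        have h2 := hlast c
        have h3 := c.isLt
        have h4 := hmono p c
        simp only [eta]
        split_ifs <;> omega
      · intro c
        have h1 := hb c
        have h2 := hmono c a
        have h3 := hmono c p
        simp only [eps]
        split_ifs <;> omega
    · rintro ⟨h1, h2⟩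
      have h3 := h1 p
      have h4 := h2 p
      have h1 := h1 a
      have h2 := h2 a
      simp only [eta, eps] at h1 h2 h3 h4
      split_ifs at h1 h2 h3 h4 <;> omega
end

section
/- Fix m ≥ 2, n ≥ 1, a ∈ {0,…,m−1}, x, and q with q + x ≤ n (and q = 0 if a = 0), and let ν ≤ μ in 𝓛(m−1,n). Then the set {λ ∈ 𝓛(m−1,n) : ν ≤ λ ≤ μ, λ_{a−1} = q, and n^λ_a = x} equals the Young-order interval [ν ∨ η^q, μ ∧ ε^q], where ∨ and ∧ denote componentwise maximum and minimum and ε^q, η^q are the helper paths: ε^q = (q,…,q, q+x, n,…,n) with a copies of q and m−a−1 copies of n, and η^q = (0,…,0, q, q+x,…,q+x, n) with a−1 copies of 0 and m−a−1 copies of q+x for a > 0, and η^0 = (x,…,x,n) for a = 0. (The interval is understood to be empty when ν ∨ η^q ≰ μ ∧ ε^q.) -/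
/-- For `ν ≤ μ` in `𝓛(W,n)`, the set of paths `λ` with `ν ≤ λ ≤ μ`,
`λ_{a-1} = q` and `n^λ_a = x` is the Young-order interval `[ν ⊔ η^q, μ ⊓ ε^q]`
(componentwise max/min), inside `𝓛(W,n)`. -/
theorem stmt5 (W n : ℕ) (hW : 1 ≤ W) (hn : 1 ≤ n) (a : Fin (W + 1)) (x q : ℕ)
    (hqx : q + x ≤ n) (ha0 : (a : ℕ) = 0 → q = 0)
    (nu mu : Fin (W + 1) → ℕ)
    (hnu : IsLP (W + 1) n nu) (hmu : IsLP (W + 1) n mu) (hnm : nu ≤ mu) :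
    {l : Fin (W + 1) → ℕ | IsLP (W + 1) n l ∧ nu ≤ l ∧ l ≤ mu ∧
        prevH l a = q ∧ stepAt l a = x}
      = {l : Fin (W + 1) → ℕ | IsLP (W + 1) n l ∧
          nu ⊔ eta W n a x q ≤ l ∧ l ≤ mu ⊓ eps W n a x q} := by
  ext l
  simp only [Set.mem_ofPred_eq, sup_le_iff, le_inf_iff]
  constructor
  · rintro ⟨hl, h1, h2, h3, h4⟩
    obtain ⟨hm, hb, hlast⟩ := hl
    have hlast' := hlast (Nat.succ_pos W)
    have hpa : prevH l a ≤ l a := by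
      unfold prevH
      split_ifs with h
      · exact Nat.zero_le _
      · apply hm
        rw [Fin.le_def]
        simp
    have hla : l a = q + x := by
      unfold stepAt at h4
      omega
    refine ⟨⟨hm, hb, hlast⟩, ⟨h1, ?_⟩, h2, ?_⟩
    · intro c
      unfold eta
      split_ifs with c1 c2 c3
      · exact Nat.zero_le _
      · have ha : (a : ℕ) ≠ 0 := by omega
        unfold prevH at h3
        rw [dif_neg ha] at h3
        have : (⟨(a : ℕ) - 1, by omega⟩ : Fin (W + 1)) = c := Fin.ext (by simp; omega)
        rw [this] at h3
        exact h3.ge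
      · rw [← hla]
        apply hm
        rw [Fin.le_def]
        omega
      · have : (⟨W + 1 - 1, by omega⟩ : Fin (W + 1)) = c := Fin.ext (by simp; omega)
        rw [this] at hlast'
        exact hlast'.ge
    · intro c
      unfold eps
      split_ifs with c1 c2
      · have ha : (a : ℕ) ≠ 0 := by omega
        unfold prevH at h3
        rw [dif_neg ha] at h3
        rw [← h3]
        apply hm
        rw [Fin.le_def]
        simp only
        omega
      · have : c = a := Fin.ext c2
        rw [this, hla]
      · exact hb c
  · rintro ⟨hl, ⟨h1, he⟩, h2, hp⟩
    have hprev : prevH l a = q := by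
      unfold prevH
      split_ifs with h
      · exact (ha0 h).symm
      · have e1 := he ⟨(a : ℕ) - 1, by omega⟩
        have e2 := hp ⟨(a : ℕ) - 1, by omega⟩
        unfold eta at e1
        unfold eps at e2
        simp only at e1 e2
        rw [if_neg (by omega), if_pos (by omega)] at e1
        rw [if_pos (by omega)] at e2
        exact le_antisymm e2 e1
    have hla : l a = q + x := by
      have e1 := he a
      have e2 := hp a
      unfold eta at e1
      unfold eps at e2
      rw [if_neg (by omega), if_neg (by omega)] at e1
      rw [if_neg (by omega), if_pos rfl] at e2
      refine le_antisymm e2 ?_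
      split_ifs at e1
      · exact e1
      · exact hqx.trans e1
    refine ⟨hl, h1, h2, hprev, ?_⟩
    unfold stepAt
    omega
end

section
/- Fix m ≥ 2, n ≥ x, and a ∈ {0,…,m−2}. The contraction C_a^x is an order isomorphism from the set D = {λ ∈ 𝓛(m−1,n) : n^λ_a = x}, equipped with the restriction of the Young order, onto 𝓛(m−2, n−x) with its Young order: C_a^x is a bijection from D to 𝓛(m−2, n−x), it is monotone, and its inverse (which inserts a component of value x at position a of the step representation) is monotone. -/
def insStep {W : ℕ} (x a : ℕ) (ha : a < W) (p : Fin W → ℕ) : Fin (W + 1) → ℕ := fun b =>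
  if hb : (b : ℕ) < a then p ⟨b, hb.trans ha⟩
  else (if h : (b : ℕ) = 0 then 0
           else p ⟨(b : ℕ) - 1, by have := b.isLt; omega⟩) + x

theorem step_facts {W n x a : ℕ} (ha : a < W) {l : Fin (W + 1) → ℕ} (hl : IsLP (W + 1) n l)
    (hs : stepAt l ⟨a, Nat.lt_succ_of_lt ha⟩ = x) :
    x ≤ l ⟨a, Nat.lt_succ_of_lt ha⟩ ∧
    (a = 0 → l ⟨a, Nat.lt_succ_of_lt ha⟩ = x) ∧
    (∀ h : a ≠ 0, l ⟨a, Nat.lt_succ_of_lt ha⟩ = l ⟨a - 1, by omega⟩ + x) := by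
  obtain ⟨hm, -, -⟩ := hl
  unfold stepAt prevH at hs
  by_cases h : a = 0
  · simp only [h, dite_true] at hs ⊢
    exact ⟨by omega, fun _ => by omega, fun h => absurd rfl h⟩
  · simp only [h, dite_false] at hs
    have : l ⟨a - 1, by omega⟩ ≤ l ⟨a, Nat.lt_succ_of_lt ha⟩ := hm (by simp)
    exact ⟨by omega, fun h' => absurd h' h, fun _ => by omega⟩

theorem contra_isLP {W n x a : ℕ} (ha : a < W) {l : Fin (W + 1) → ℕ} (hl : IsLP (W + 1) n l)
    (hs : stepAt l ⟨a, Nat.lt_succ_of_lt ha⟩ = x) :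
    IsLP W (n - x) (contra x a l : Fin W → ℕ) := by
  obtain ⟨h1, h2, h3⟩ := step_facts ha hl hs
  obtain ⟨hm, hb, hlast⟩ := hl
  have hlast' : l ⟨W, by omega⟩ = n := hlast (by omega)
  have mono : Monotone (contra x a l : Fin W → ℕ) := by
    intro b c hbc
    have hbc' : (b : ℕ) ≤ c := hbc
    have hc := c.isLt
    unfold contra
    by_cases hba : (b : ℕ) < a <;> by_cases hca : (c : ℕ) < a
    · simp only [hba, hca, if_true]
      exact hm hbc
    · simp only [hba, hca, if_true, if_false]
      have e1 := h3 (by omega)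
      have e2 : l ⟨b, by omega⟩ ≤ l ⟨a - 1, by omega⟩ := hm (by
        simp only [Fin.mk_le_mk]; omega)
      have e3 : l ⟨a, by omega⟩ ≤ l ⟨c + 1, by omega⟩ := hm (by
        simp only [Fin.mk_le_mk]; omega)
      omega
    · omega
    · simp only [hba, hca, if_false]
      exact Nat.sub_le_sub_right (hm (by simp only [Fin.mk_le_mk]; omega)) x
  have last : ∀ h : 0 < W,
      (contra x a l : Fin W → ℕ) ⟨W - 1, Nat.sub_lt h Nat.one_pos⟩ = n - x := by
    intro h
    unfold contra
    have : ¬ (W - 1 < a) := by omega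
    simp only [this, if_false]
    have e : W - 1 + 1 = W := by omega
    simp only [e, hlast']
  refine ⟨mono, fun b => ?_, last⟩
  rw [← last (by omega)]
  exact mono (by have := b.isLt; rw [Fin.le_def]; simp only; omega)

theorem ins_isLP {W n x a : ℕ} (hx : x ≤ n) (ha : a < W) {p : Fin W → ℕ}
    (hp : IsLP W (n - x) p) :
    IsLP (W + 1) n (insStep x a ha p) ∧
      stepAt (insStep x a ha p) ⟨a, Nat.lt_succ_of_lt ha⟩ = x := by
  obtain ⟨hm, hb, hlast⟩ := hp
  have hlast' := hlast (by omega)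
  have mono : Monotone (insStep x a ha p) := by
    intro b c hbc
    have hbc' : (b : ℕ) ≤ c := hbc
    have hc := c.isLt
    unfold insStep
    by_cases hba : (b : ℕ) < a <;> by_cases hca : (c : ℕ) < a
    · simp only [hba, hca, dite_true]
      exact hm hbc
    · have hc0 : (c : ℕ) ≠ 0 := by omega
      simp only [hba, hca, hc0, dite_true, dite_false]
      exact (hm (by simp only [Fin.mk_le_mk]; omega)).trans (Nat.le_add_right _ _)
    · omega
    · by_cases hb0 : (b : ℕ) = 0
      · simp only [hba, hca, hb0, dite_true, dite_false]
        split_ifs <;> omega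
      · have hc0 : (c : ℕ) ≠ 0 := by omega
        simp only [hba, hca, hb0, hc0, dite_false]
        exact Nat.add_le_add_right (hm (by simp only [Fin.mk_le_mk]; omega)) x
  have last : insStep x a ha p ⟨W, by omega⟩ = n := by
    unfold insStep
    have w1 : ¬ W < a := by omega
    have w2 : W ≠ 0 := by omega
    simp only [w1, w2, dite_false, hlast']
    omega
  refine ⟨⟨mono, fun b => ?_, fun _ => last⟩, ?_⟩
  · rw [← last]
    exact mono (by have := b.isLt; rw [Fin.le_def]; simp only; omega)
  · unfold stepAt prevH insStep
    by_cases h : a = 0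
    · simp [h]
    · have : a - 1 < a := by omega
      simp [h, this]

theorem ins_contra {W n x a : ℕ} (ha : a < W) {l : Fin (W + 1) → ℕ} (hl : IsLP (W + 1) n l)
    (hs : stepAt l ⟨a, Nat.lt_succ_of_lt ha⟩ = x) :
    insStep x a ha (contra x a l : Fin W → ℕ) = l := by
  obtain ⟨h1, h2, h3⟩ := step_facts ha hl hs
  obtain ⟨hm, -, -⟩ := hl
  funext ⟨b, hb⟩
  unfold insStep contra
  by_cases hba : b < a
  · simp only [hba, dite_true, if_true]
  · by_cases hb0 : b = 0
    · have ha0 : a = 0 := by omega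
      subst ha0 hb0
      simpa using (h2 rfl).symm
    · simp only [hba, hb0, dite_false]
      by_cases hb1 : b - 1 < a
      · obtain rfl : b = a := by omega
        simp only [hb1, if_true]
        exact (h3 hb0).symm
      · have e : b - 1 + 1 = b := by omega
        simp only [hb1, if_false, e]
        have : l ⟨a, by omega⟩ ≤ l ⟨b, hb⟩ := hm (by simp only [Fin.mk_le_mk]; omega)
        omega

theorem contra_ins {W x a : ℕ} (ha : a < W) (p : Fin W → ℕ) :
    (contra x a (insStep x a ha p) : Fin W → ℕ) = p := by
  funext ⟨b, hb⟩
  unfold insStep contra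
  by_cases hba : b < a
  · simp only [hba, dite_true, if_true]
  · have : ¬ b + 1 < a := by omega
    simp [hba, this]

theorem contra_mono {W x a : ℕ} {l k : Fin (W + 1) → ℕ} (h : l ≤ k) :
    (contra x a l : Fin W → ℕ) ≤ contra x a k := by
  intro b
  unfold contra
  split_ifs
  · exact h _
  · exact Nat.sub_le_sub_right (h _) x

theorem ins_mono {W x a : ℕ} (ha : a < W) {p q : Fin W → ℕ} (h : p ≤ q) :
    insStep x a ha p ≤ insStep x a ha q := by
  intro b
  unfold insStep
  split_ifs
  · exact h _
  · exact le_rfl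
  · exact Nat.add_le_add_right (h _) x

/-- The contraction `C_a^x` is an order isomorphism from
`D = {λ ∈ 𝓛(W,n) : n^λ_a = x}` (with the restricted Young order) onto `𝓛(W-1, n-x)`:
a monotone bijection whose (monotone) inverse inserts a step of value `x` at position `a`. -/
theorem stmt8 (W n x : ℕ) (hW : 1 ≤ W) (hx : x ≤ n) (a : ℕ) (ha : a < W) :
    ∃ e : {l : Fin (W + 1) → ℕ //
            IsLP (W + 1) n l ∧ stepAt l ⟨a, Nat.lt_succ_of_lt ha⟩ = x}
          ≃o {p : Fin W → ℕ // IsLP W (n - x) p},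
      (∀ l, (e l : Fin W → ℕ) = contra x a l.1) ∧
      (∀ p (b : Fin (W + 1)) (hb : (b : ℕ) < a),
        (e.symm p : Fin (W + 1) → ℕ) b = p.1 ⟨b, hb.trans ha⟩) ∧
      (∀ p (b : Fin (W + 1)) (_ : a ≤ (b : ℕ)),
        (e.symm p : Fin (W + 1) → ℕ) b =
          (if h : (b : ℕ) = 0 then 0
           else p.1 ⟨(b : ℕ) - 1, by have := b.isLt; omega⟩) + x) := by
  refine ⟨{ toFun := fun l => ⟨contra x a l.1, contra_isLP ha l.2.1 l.2.2⟩
            invFun := fun p => ⟨insStep x a ha p.1, ins_isLP hx ha p.2⟩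
            left_inv := fun l => Subtype.ext (ins_contra ha l.2.1 l.2.2)
            right_inv := fun p => Subtype.ext (contra_ins ha p.1)
            map_rel_iff' := ?_ }, fun _ => rfl, ?_, ?_⟩
  · intro l k
    constructor
    · intro h
      have h' := ins_mono (x := x) ha (show (contra x a l.1 : Fin W → ℕ) ≤ contra x a k.1 from h)
      rw [ins_contra ha l.2.1 l.2.2, ins_contra ha k.2.1 k.2.2] at h'
      exact h'
    · intro h
      exact contra_mono (show l.1 ≤ k.1 from h)
  · intro p b hb
    change insStep x a ha p.1 b = _
    simp only [insStep, hb, dite_true]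
  · intro p b hb
    change insStep x a ha p.1 b = _
    simp only [insStep, not_lt.mpr hb, dite_false]
end

section
/- Fix m ≥ 3, n ≥ 1, a ∈ {1,…,m−2}, x, and q with q + 1 + x ≤ n. Let Ẽ(q+1) = C_a^x(E(q+1)) ⊆ 𝓛(m−2, n−x) be the contracted helper diagram, which is the interval [C_a^x(η^{q+1}), C_a^x(ε^{q+1})]. If (λ, κ) belongs to the lower boundary ∂Ẽ(q+1), then the unique index b at which λ and κ differ is b = a−1; that is, λ_{a−1} = κ_{a−1} − 1 = q and λ_c = κ_c for all c ≠ a−1. -/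
/-- Let `m = W+1 ≥ 3`, `n ≥ 1`, `a ∈ {1,…,W-1}`, and `q + 1 + x ≤ n`.
Let `Ẽ(q+1) = [C_a^x(η^{q+1}), C_a^x(ε^{q+1})] ⊆ 𝓛(W-1, n-x)` be the contracted helper
diagram.  If `(λ, κ)` lies in the lower boundary `∂Ẽ(q+1)` (i.e. `κ ∈ Ẽ(q+1)`,
`λ ∉ Ẽ(q+1)`, `λ` covered by `κ`), then the unique index where `λ` and `κ` differ is
`a - 1`: `λ_{a-1} = q`, `κ_{a-1} = q + 1`, and `λ_c = κ_c` for all `c ≠ a - 1`. -/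
theorem stmt10 (W n : ℕ) (hW : 2 ≤ W) (hn : 1 ≤ n) (a : ℕ) (ha1 : 1 ≤ a) (ha2 : a < W)
    (x q : ℕ) (hq : q + 1 + x ≤ n)
    (lam kap : {p : Fin W → ℕ // IsLP W (n - x) p})
    (hkap : contra x a (eta W n a x (q + 1)) ≤ kap.1 ∧
            kap.1 ≤ contra x a (eps W n a x (q + 1)))
    (hlam : ¬(contra x a (eta W n a x (q + 1)) ≤ lam.1 ∧
              lam.1 ≤ contra x a (eps W n a x (q + 1))))
    (hcov : lam ⋖ kap) :
    lam.1 ⟨a - 1, by omega⟩ = q ∧ kap.1 ⟨a - 1, by omega⟩ = q + 1 ∧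
      ∀ c : Fin W, (c : ℕ) ≠ a - 1 → lam.1 c = kap.1 c := by
  obtain ⟨l, hlm, hlb, hll⟩ := lam
  obtain ⟨k, hkm, hkb, hkl⟩ := kap
  have hle : l ≤ k := hcov.1.le
  simp only at hkap hlam ⊢
  obtain ⟨hk1, hk2⟩ := hkap
  have hlu : l ≤ contra x a (eps W n a x (q + 1)) := le_trans hle hk2
  have hll' := hll (by omega)
  have hkl' := hkl (by omega)
  have hka : k ⟨a - 1, by omega⟩ = q + 1 := by
    have h1 := hk1 ⟨a - 1, by omega⟩
    have h2 := hk2 ⟨a - 1, by omega⟩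
    have e1 : a - 1 < a := by omega
    have e2 : a - 1 + 1 = a := by omega
    simp [contra, eta, eps, e1, e2] at h1 h2
    omega
  have hla : l ⟨a - 1, by omega⟩ ≤ q := by
    by_contra hcon
    apply hlam
    refine ⟨?_, hlu⟩
    intro c
    by_cases h0 : (c : ℕ) + 1 < a
    · have e : (c : ℕ) < a := by omega
      simp [contra, eta, h0, e]
    · have hm : l ⟨a - 1, by omega⟩ ≤ l c := hlm (by rw [Fin.le_def]; simp only; omega)
      by_cases hc : (c : ℕ) = W - 1
      · have ec : c = ⟨W - 1, by omega⟩ := Fin.ext hc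
        have e1 : ¬ (c : ℕ) < a := by omega
        have : l c = n - x := by rw [ec]; exact hll'
        rw [this]
        simp only [contra, eta]
        split_ifs <;> omega
      · have := c.isLt
        simp only [contra, eta]
        split_ifs <;> omega
  have hex : ∃ j, ∃ h : j < W, l ⟨j, h⟩ < k ⟨j, h⟩ := ⟨a - 1, by omega, by omega⟩
  classical
  obtain ⟨hbW, hb⟩ := Nat.find_spec hex
  have hmin : ∀ c : Fin W, (c : ℕ) < Nat.find hex → l c = k c := by
    intro c hc
    have h1 := Nat.find_min hex hc
    have h2 := hle c
    push Not at h1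
    exact le_antisymm h2 (h1 c.isLt)
  generalize Nat.find hex = b at hbW hb hmin
  set B : Fin W := ⟨b, hbW⟩ with hB
  have hbl : b ≠ W - 1 := by
    rintro rfl
    have h1 : l B = n - x := hll'
    have h2 : k B = n - x := hkl'
    omega
  have hpm : IsLP W (n - x) (Function.update k B (k B - 1)) := by
    refine ⟨?_, ?_, ?_⟩
    · intro c d hcd
      have hk := hkm hcd
      by_cases hd : d = B
      · subst hd
        by_cases hc : c = B
        · simp [hc]
        · have hlt : c < B := lt_of_le_of_ne hcd hc
          have h1 := hmin c hlt
          have h2 := hlm hcd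
          rw [Function.update_of_ne hc, Function.update_self]
          omega
      · rw [Function.update_of_ne hd]
        by_cases hc : c = B
        · subst hc
          rw [Function.update_self]
          omega
        · rwa [Function.update_of_ne hc]
    · intro c
      have := hkb c
      by_cases hc : c = B
      · subst hc
        rw [Function.update_self]
        omega
      · rwa [Function.update_of_ne hc]
    · intro h
      rw [Function.update_of_ne]
      · exact hkl'
      · intro e
        exact hbl (congrArg Fin.val e).symm
  have hlp : l ≤ Function.update k B (k B - 1) := by
    intro c
    by_cases hc : c = B
    · rw [hc, Function.update_self]
      exact Nat.le_sub_one_of_lt hb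
    · rw [Function.update_of_ne hc]
      exact hle c
  have hpk : Function.update k B (k B - 1) ≤ k := by
    intro c
    by_cases hc : c = B
    · rw [hc, Function.update_self]
      exact Nat.sub_le _ _
    · rw [Function.update_of_ne hc]
  have heq : l = Function.update k B (k B - 1) := by
    rcases hcov.eq_or_eq (c := ⟨_, hpm⟩) hlp hpk with h | h
    · exact (congrArg Subtype.val h).symm
    · have h1 := congrFun (congrArg Subtype.val h) B
      simp only [Function.update_self] at h1
      omega
  have hne : ∀ c, c ≠ B → l c = k c := by
    intro c hc
    rw [heq, Function.update_of_ne hc]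
  have hBa : (⟨a - 1, by omega⟩ : Fin W) = B := by
    by_contra h
    have := hne _ h
    omega
  have hlB : l B = k B - 1 := by
    have := congrFun heq B
    rwa [Function.update_self] at this
  refine ⟨?_, hka, ?_⟩
  · rw [hBa] at hka ⊢
    omega
  · intro c hc
    apply hne
    rw [← hBa]
    intro e
    exact hc (congrArg Fin.val e)
end

section
/- Fix m ≥ 3, n ≥ 1, a ∈ {1,…,m−2}, x, and q with q + 1 + x ≤ n. Let Ẽ(q) = C_a^x(E(q)) and Ẽ(q+1) = C_a^x(E(q+1)) be the contracted helper diagrams in 𝓛(m−2, n−x). If (λ, κ) belongs to the lower boundary ∂Ẽ(q+1), then λ ∈ Ẽ(q). -/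
/-- Same setting as Statement 10, with the contracted helper diagrams
`Ẽ(q) = [C_a^x(η^q), C_a^x(ε^q)]` and `Ẽ(q+1) = [C_a^x(η^{q+1}), C_a^x(ε^{q+1})]` in
`𝓛(W-1, n-x)`.  If `(λ, κ)` lies in the lower boundary `∂Ẽ(q+1)`, then `λ ∈ Ẽ(q)`. -/
theorem stmt11 (W n : ℕ) (hW : 2 ≤ W) (hn : 1 ≤ n) (a : ℕ) (ha1 : 1 ≤ a) (ha2 : a < W)
    (x q : ℕ) (hq : q + 1 + x ≤ n)
    (lam kap : {p : Fin W → ℕ // IsLP W (n - x) p})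
    (hkap : contra x a (eta W n a x (q + 1)) ≤ kap.1 ∧
            kap.1 ≤ contra x a (eps W n a x (q + 1)))
    (hlam : ¬(contra x a (eta W n a x (q + 1)) ≤ lam.1 ∧
              lam.1 ≤ contra x a (eps W n a x (q + 1))))
    (hcov : lam ⋖ kap) :
    contra x a (eta W n a x q) ≤ lam.1 ∧ lam.1 ≤ contra x a (eps W n a x q) := by
  obtain ⟨l, hlm, hlb, hll⟩ := lam
  obtain ⟨k, hkm, hkb, hkl⟩ := kap
  have hW0 : 0 < W := by omega
  have hll := hll hW0
  have hkl := hkl hW0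
  have hle : ∀ b, l b ≤ k b := fun b => hcov.1.le b
  let c : Fin W := ⟨a - 1, by omega⟩
  have hkc : k c = q + 1 := by
    have h1 := hkap.1 c
    have h2 := hkap.2 c
    have e1 : a - 1 < a := by omega
    have e2 : a - 1 + 1 = a := by omega
    simp [contra, eta, eps, c, e1, e2] at h1 h2
    exact le_antisymm h2 h1
  have hlc : l c ≤ q := by
    by_contra hcon
    apply hlam
    have hlc : l c = q + 1 := by have := hle c; omega
    constructor
    · intro b
      show contra x a (eta W n a x (q + 1)) b ≤ l b
      have hb : (b : ℕ) < W := b.isLt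
      have hmono : a - 1 ≤ (b : ℕ) → l c ≤ l b := fun h => hlm h
      have hlast : (b : ℕ) = W - 1 → l b = n - x := by
        intro h
        rw [← hll]; congr 1; exact Fin.ext h
      simp only [contra, eta]
      split_ifs <;> omega
    · intro b
      exact (hle b).trans (hkap.2 b)
  have hlc2 : q ≤ l c := by
    by_contra hcon
    let μ : {p : Fin W → ℕ // IsLP W (n - x) p} := ⟨fun b => max (l b) (min (k b) q), by
      refine ⟨?_, ?_, ?_⟩
      · intro b d hbd
        have h1 := hlm hbd
        have h2 := hkm hbd
        show max (l b) (min (k b) q) ≤ max (l d) (min (k d) q)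
        omega
      · intro b
        have := hlb b
        have := hkb b
        show max (l b) (min (k b) q) ≤ n - x
        omega
      · intro h
        show max (l _) (min (k _) q) = n - x
        rw [hll, hkl]; omega⟩
    refine hcov.2 (c := μ) ?_ ?_
    · refine lt_of_le_not_ge (fun b => le_max_left _ _) (fun h => ?_)
      have h3 : max (l c) (min (k c) q) ≤ l c := h c
      omega
    · refine lt_of_le_not_ge (fun b => ?_) (fun h => ?_)
      · show max (l b) (min (k b) q) ≤ k b
        have := hle b
        omega
      · have h3 : k c ≤ max (l c) (min (k c) q) := h c
        omega
  constructor
  · intro b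
    show contra x a (eta W n a x q) b ≤ l b
    have hb : (b : ℕ) < W := b.isLt
    have hmono : a - 1 ≤ (b : ℕ) → l c ≤ l b := fun h => hlm h
    have hlast : (b : ℕ) = W - 1 → l b = n - x := by
      intro h
      rw [← hll]; congr 1; exact Fin.ext h
    simp only [contra, eta]
    split_ifs <;> omega
  · intro b
    show l b ≤ contra x a (eps W n a x q) b
    have hb : (b : ℕ) < W := b.isLt
    have hmono : (b : ℕ) ≤ a - 1 → l b ≤ l c := fun h => hlm h
    have hbd : l b ≤ n - x := hlb b
    simp only [contra, eps]
    split_ifs <;> omega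
end

section
/- Fix m ≥ 2, n ≥ 1, a ∈ {0,…,m−2}, x ≤ n, and μ ∈ 𝓛(m−1,n) with x ≤ μ_a, and set q_max = min{μ_{a−1}, μ_a − x} for a > 0 and q_max = 0 for a = 0. Then the image under the contraction C_a^x of the set {λ ∈ 𝓛(m−1,n) : λ ≤ μ and n^λ_a = x} is exactly the downset ↓(C_a^x(μ ∧ ε^{q_max})) = {κ ∈ 𝓛(m−2, n−x) : κ ≤ C_a^x(μ ∧ ε^{q_max})} in 𝓛(m−2, n−x), where μ ∧ ε^{q_max} is the componentwise minimum of μ and the helper top path ε^{q_max}. Moreover C_a^x is injective on this set, so the two sets have equal cardinality. -/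
/-- For `μ ∈ 𝓛(W,n)`, `a ∈ {0,…,W-1}`, `x ≤ n`, `x ≤ μ_a`, and
`q_max = min {μ_{a-1}, μ_a - x}` (`q_max = 0` for `a = 0`), the image under `C_a^x` of
`{λ ∈ 𝓛(W,n) : λ ≤ μ, n^λ_a = x}` is the downset `↓ C_a^x(μ ⊓ ε^{q_max})` in
`𝓛(W-1, n-x)`; moreover `C_a^x` is injective on this set, so the cardinalities agree. -/
theorem stmt13 (W n : ℕ) (hW : 1 ≤ W) (hn : 1 ≤ n) (a : ℕ) (ha : a < W)
    (x : ℕ) (hx : x ≤ n) (mu : Fin (W + 1) → ℕ) (hmu : IsLP (W + 1) n mu)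
    (hxmu : x ≤ mu ⟨a, Nat.lt_succ_of_lt ha⟩)
    (qmax : ℕ)
    (hqmax : qmax = if a = 0 then 0
      else min (prevH mu ⟨a, Nat.lt_succ_of_lt ha⟩) (mu ⟨a, Nat.lt_succ_of_lt ha⟩ - x)) :
    contra x a '' {l : Fin (W + 1) → ℕ | IsLP (W + 1) n l ∧ l ≤ mu ∧
        stepAt l ⟨a, Nat.lt_succ_of_lt ha⟩ = x}
      = {p : Fin W → ℕ | IsLP W (n - x) p ∧ p ≤ contra x a (mu ⊓ eps W n a x qmax)} ∧
    Set.InjOn (contra x a) {l : Fin (W + 1) → ℕ | IsLP (W + 1) n l ∧ l ≤ mu ∧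
        stepAt l ⟨a, Nat.lt_succ_of_lt ha⟩ = x} ∧
    Set.ncard {l : Fin (W + 1) → ℕ | IsLP (W + 1) n l ∧ l ≤ mu ∧
        stepAt l ⟨a, Nat.lt_succ_of_lt ha⟩ = x}
      = Set.ncard {p : Fin W → ℕ | IsLP W (n - x) p ∧
          p ≤ contra x a (mu ⊓ eps W n a x qmax)} := by
  have hcon : ∀ (l : Fin (W + 1) → ℕ) (b : ℕ) (hb : b < W), contra x a l ⟨b, hb⟩ =
      if b < a then l ⟨b, by omega⟩ else l ⟨b + 1, by omega⟩ - x := fun l b hb => rfl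
  obtain ⟨hmm, hmn, hml⟩ := hmu
  -- the structure of paths with prescribed step
  have hstep : ∀ l : Fin (W + 1) → ℕ, Monotone l → stepAt l ⟨a, Nat.lt_succ_of_lt ha⟩ = x →
      l ⟨a, Nat.lt_succ_of_lt ha⟩ = prevH l ⟨a, Nat.lt_succ_of_lt ha⟩ + x := by
    intro l hl hs
    have : prevH l ⟨a, Nat.lt_succ_of_lt ha⟩ ≤ l ⟨a, Nat.lt_succ_of_lt ha⟩ := by
      unfold prevH
      split_ifs with h
      · exact Nat.zero_le _
      · apply hl
        simp
    unfold stepAt at hs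
    omega
  have hinj : Set.InjOn (contra x a) {l : Fin (W + 1) → ℕ | IsLP (W + 1) n l ∧ l ≤ mu ∧
        stepAt l ⟨a, Nat.lt_succ_of_lt ha⟩ = x} := by
    rintro l ⟨⟨hl, -, -⟩, -, hs⟩ k ⟨⟨hk, -, -⟩, -, ks⟩ h
    have hl1 := hstep l hl hs
    have hk1 := hstep k hk ks
    have key : ∀ (b : ℕ) (hb : b < W), contra x a l ⟨b, hb⟩ = contra x a k ⟨b, hb⟩ :=
      fun b hb => congrFun h ⟨b, hb⟩
    simp only [hcon] at key
    funext ⟨c, hc⟩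
    rcases lt_trichotomy c a with h1 | h1 | h1
    · have := key c (by omega)
      simpa [h1] using this
    · subst h1
      rw [hl1, hk1]
      unfold prevH
      split_ifs with h2
      · rfl
      · simp only at h2
        have := key (c - 1) (by omega)
        rw [if_pos (by omega), if_pos (by omega)] at this
        simp only [this]
    · obtain ⟨d, rfl⟩ : ∃ d, c = d + 1 := ⟨c - 1, by omega⟩
      have := key d (by omega)
      rw [if_neg (by omega), if_neg (by omega)] at this
      have e1 : l ⟨a, Nat.lt_succ_of_lt ha⟩ ≤ l ⟨d + 1, hc⟩ := hl (by simp; omega)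
      have e2 : k ⟨a, Nat.lt_succ_of_lt ha⟩ ≤ k ⟨d + 1, hc⟩ := hk (by simp; omega)
      omega
  have himg : contra x a '' {l : Fin (W + 1) → ℕ | IsLP (W + 1) n l ∧ l ≤ mu ∧
        stepAt l ⟨a, Nat.lt_succ_of_lt ha⟩ = x}
      = {p : Fin W → ℕ | IsLP W (n - x) p ∧ p ≤ contra x a (mu ⊓ eps W n a x qmax)} := by
    apply Set.Subset.antisymm
    · rintro _ ⟨l, ⟨⟨hl, hln, hll⟩, hlm, hs⟩, rfl⟩
      have hl1 := hstep l hl hs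
      have hprev : ∀ (b : ℕ) (hb : b < a), l ⟨b, by omega⟩ + x ≤ l ⟨a, Nat.lt_succ_of_lt ha⟩ := by
        intro b hb
        rw [hl1]
        unfold prevH
        rw [dif_neg (by simp; omega)]
        have : l ⟨b, by omega⟩ ≤ l ⟨a - 1, by omega⟩ := hl (by simp; omega)
        simp only
        omega
      refine ⟨⟨?_, ?_, ?_⟩, ?_⟩
      · rintro ⟨b, hb⟩ ⟨c, hc⟩ hbc
        simp only [Fin.mk_le_mk] at hbc
        rw [hcon, hcon]
        split_ifs with h1 h2 h2
        · exact hl (by simpa using hbc)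
        · have := hprev b h1
          have : l ⟨a, Nat.lt_succ_of_lt ha⟩ ≤ l ⟨c + 1, by omega⟩ := hl (by simp; omega)
          omega
        · omega
        · have : l ⟨b + 1, by omega⟩ ≤ l ⟨c + 1, by omega⟩ := hl (by simpa using hbc)
          omega
      · rintro ⟨b, hb⟩
        change contra x a l ⟨b, hb⟩ ≤ _
        rw [hcon]
        split_ifs with h1
        · have := hprev b h1
          have := hln ⟨a, Nat.lt_succ_of_lt ha⟩
          omega
        · have := hln ⟨b + 1, by omega⟩
          omega
      · intro h
        change contra x a l ⟨W - 1, by omega⟩ = _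
        rw [hcon, if_neg (by omega)]
        have := hll (by omega)
        have e : (⟨W - 1 + 1, by omega⟩ : Fin (W + 1)) = ⟨W + 1 - 1, by omega⟩ := by
          ext; simp; omega
        rw [e, this]
      · rintro ⟨b, hb⟩
        change contra x a l ⟨b, hb⟩ ≤ contra x a _ ⟨b, hb⟩
        rw [hcon, hcon]
        split_ifs with h1
        · simp only [Pi.inf_apply, eps, h1, if_true]
          apply le_min (hlm _)
          rw [hqmax, if_neg (by omega)]
          apply le_min
          · unfold prevH
            rw [dif_neg (by simp; omega)]
            exact (hl (by simp; omega)).trans (hlm _)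
          · have := hprev b h1
            have : l ⟨a, Nat.lt_succ_of_lt ha⟩ ≤ mu ⟨a, Nat.lt_succ_of_lt ha⟩ := hlm _
            exact Nat.le_sub_of_add_le (by omega)
        · apply Nat.sub_le_sub_right
          simp only [Pi.inf_apply, eps]
          rw [if_neg (by omega), if_neg (by omega)]
          exact le_min (hlm _) (hln _)
    · rintro p ⟨⟨hp, hpn, hpl⟩, hpm⟩
      have hpm' : ∀ (b : ℕ) (hb : b < W), p ⟨b, hb⟩ ≤
          contra x a (mu ⊓ eps W n a x qmax) ⟨b, hb⟩ := fun b hb => hpm ⟨b, hb⟩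
      have hlo : ∀ (b : ℕ) (hb : b < a), p ⟨b, by omega⟩ ≤ mu ⟨b, by omega⟩ ∧
          p ⟨b, by omega⟩ + x ≤ mu ⟨a, Nat.lt_succ_of_lt ha⟩ := by
        intro b hb
        have := hpm' b (by omega)
        rw [hcon, if_pos hb] at this
        simp only [Pi.inf_apply, eps, hb, if_true] at this
        have h1 := this.trans (min_le_left _ _)
        have h2 := this.trans (min_le_right _ _)
        rw [hqmax, if_neg (by omega)] at h2
        have h3 := h2.trans (min_le_right _ _)
        exact ⟨h1, by omega⟩
      have hhi : ∀ (b : ℕ) (hb : b < W), a ≤ b → p ⟨b, hb⟩ + x ≤ mu ⟨b + 1, by omega⟩ := by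
        intro b hb hab
        have := hpm' b hb
        rw [hcon, if_neg (by omega)] at this
        have h1 := this.trans (Nat.sub_le_sub_right (min_le_left _ _) _)
        have h2 : mu ⟨a, Nat.lt_succ_of_lt ha⟩ ≤ mu ⟨b + 1, by omega⟩ := hmm (by simp; omega)
        omega
      let l : Fin (W + 1) → ℕ := fun c =>
        if h : (c : ℕ) < a then p ⟨c, by omega⟩
        else if h0 : (c : ℕ) = 0 then x else p ⟨(c : ℕ) - 1, by omega⟩ + x
      have hl1 : ∀ (c : ℕ) (hc : c < W + 1) (h : c < a), l ⟨c, hc⟩ = p ⟨c, by omega⟩ :=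
        fun c hc h => dif_pos h
      have hl2 : ∀ (c : ℕ) (hc : c < W + 1) (h : ¬ c < a) (h0 : c = 0), l ⟨c, hc⟩ = x :=
        fun c hc h h0 => by simp only [l]; rw [dif_neg h, dif_pos h0]
      have hl3 : ∀ (c : ℕ) (hc : c < W + 1) (h : ¬ c < a) (h0 : c ≠ 0),
          l ⟨c, hc⟩ = p ⟨c - 1, by omega⟩ + x :=
        fun c hc h h0 => by simp only [l]; rw [dif_neg h, dif_neg h0]
      refine ⟨l, ⟨⟨?_, ?_, ?_⟩, ?_, ?_⟩, ?_⟩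
      · rintro ⟨b, hb⟩ ⟨c, hc⟩ hbc
        simp only [Fin.mk_le_mk] at hbc
        by_cases h1 : b < a
        · rw [hl1 b hb h1]
          by_cases h2 : c < a
          · rw [hl1 c hc h2]
            exact hp (by simpa using hbc)
          · rw [hl3 c hc h2 (by omega)]
            have : p ⟨b, by omega⟩ ≤ p ⟨c - 1, by omega⟩ := hp (by simp; omega)
            omega
        · by_cases h0 : b = 0
          · rw [hl2 b hb h1 h0]
            by_cases h3 : c = 0
            · rw [hl2 c hc (by omega) h3]
            · rw [hl3 c hc (by omega) h3]
              omega
          · rw [hl3 b hb h1 h0, hl3 c hc (by omega) (by omega)]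
            have : p ⟨b - 1, by omega⟩ ≤ p ⟨c - 1, by omega⟩ := hp (by simp; omega)
            omega
      · rintro ⟨b, hb⟩
        by_cases h1 : b < a
        · rw [hl1 b hb h1]
          have := hpn ⟨b, by omega⟩
          omega
        · by_cases h0 : b = 0
          · rw [hl2 b hb h1 h0]
            exact hx
          · rw [hl3 b hb h1 h0]
            have := hpn ⟨b - 1, by omega⟩
            omega
      · intro h
        rw [hl3 (W + 1 - 1) _ (by omega) (by omega)]
        have := hpl (by omega)
        simp only [Nat.add_sub_cancel]
        omega
      · rintro ⟨b, hb⟩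
        by_cases h1 : b < a
        · rw [hl1 b hb h1]
          exact (hlo b h1).1
        · by_cases h0 : b = 0
          · rw [hl2 b hb h1 h0]
            have : mu ⟨a, Nat.lt_succ_of_lt ha⟩ ≤ mu ⟨b, hb⟩ := hmm (by simp; omega)
            exact hxmu.trans this
          · rw [hl3 b hb h1 h0]
            by_cases h2 : b = a
            · subst h2
              exact (hlo (b - 1) (by omega)).2
            · have := hhi (b - 1) (by omega) (by omega)
              have e : (⟨b - 1 + 1, by omega⟩ : Fin (W + 1)) = ⟨b, hb⟩ := by
                ext; simp; omega
              rwa [e] at this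
      · unfold stepAt prevH
        by_cases h0 : a = 0
        · rw [hl2 a _ (by omega) h0, dif_pos h0]
          omega
        · rw [hl3 a _ (by omega) h0, dif_neg h0]
          simp only
          rw [hl1 (a - 1) _ (by omega)]
          omega
      · funext ⟨b, hb⟩
        change contra x a l ⟨b, hb⟩ = _
        rw [hcon]
        split_ifs with h1
        · rw [hl1 b _ h1]
        · rw [hl3 (b + 1) _ (by omega) (by omega)]
          simp
  refine ⟨himg, hinj, ?_⟩
  rw [← himg, hinj.ncard_image]
end

section
/- Fix m ≥ 2, n ≥ 1, a ∈ {0,…,m−2}, x ≤ n, and μ ∈ 𝓛(m−1,n) with x ≤ μ_a, and set q_max = min{μ_{a−1}, μ_a − x} for a > 0 and q_max = 0 for a = 0. Under the uniform probability distribution on the downset ↓μ = {λ ∈ 𝓛(m−1,n) : λ ≤ μ}, the probability that a path λ satisfies n^λ_a = x equals the ratio of cardinalities |↓(C_a^x(μ ∧ ε^{q_max}))| / |↓μ|, where the numerator is the number of paths in 𝓛(m−2, n−x) below the contraction of μ ∧ ε^{q_max}. -/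
/-- Under the uniform probability distribution on the downset
`↓μ ⊆ 𝓛(W,n)` (so the probability of an event is its cardinality divided by `|↓μ|`), the
probability that a path `λ` satisfies `n^λ_a = x` equals
`|↓ C_a^x(μ ⊓ ε^{q_max})| / |↓μ|`, the numerator counting paths of `𝓛(W-1, n-x)` below the
contraction of `μ ⊓ ε^{q_max}`. -/
theorem stmt14 (W n : ℕ) (hW : 1 ≤ W) (hn : 1 ≤ n) (a : ℕ) (ha : a < W)
    (x : ℕ) (hx : x ≤ n) (mu : Fin (W + 1) → ℕ) (hmu : IsLP (W + 1) n mu)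
    (hxmu : x ≤ mu ⟨a, Nat.lt_succ_of_lt ha⟩)
    (qmax : ℕ)
    (hqmax : qmax = if a = 0 then 0
      else min (prevH mu ⟨a, Nat.lt_succ_of_lt ha⟩) (mu ⟨a, Nat.lt_succ_of_lt ha⟩ - x)) :
    (Set.ncard {l : Fin (W + 1) → ℕ | IsLP (W + 1) n l ∧ l ≤ mu ∧
        stepAt l ⟨a, Nat.lt_succ_of_lt ha⟩ = x} : ℝ) /
      (Set.ncard {l : Fin (W + 1) → ℕ | IsLP (W + 1) n l ∧ l ≤ mu} : ℝ)
    = (Set.ncard {p : Fin W → ℕ | IsLP W (n - x) p ∧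
          p ≤ contra x a (mu ⊓ eps W n a x qmax)} : ℝ) /
      (Set.ncard {l : Fin (W + 1) → ℕ | IsLP (W + 1) n l ∧ l ≤ mu} : ℝ) := by
  congr 2
  have hmono : ∀ i j (hi : i < W + 1) (hj : j < W + 1), i ≤ j → mu ⟨i, hi⟩ ≤ mu ⟨j, hj⟩ :=
    fun i j hi hj h => hmu.1 (by simpa using h)
  have hmun : ∀ i (hi : i < W + 1), mu ⟨i, hi⟩ ≤ n := fun i hi => hmu.2.1 _
  have hstep : ∀ l : Fin (W + 1) → ℕ, IsLP (W + 1) n l →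
      stepAt l ⟨a, Nat.lt_succ_of_lt ha⟩ = x →
      (∀ i j (hi : i < W + 1) (hj : j < W + 1), i ≤ j → l ⟨i, hi⟩ ≤ l ⟨j, hj⟩) ∧
      l ⟨a, Nat.lt_succ_of_lt ha⟩
        = (if h : a = 0 then 0 else l ⟨a - 1, by omega⟩) + x := by
    intro l hl hs
    have hm : ∀ i j (hi : i < W + 1) (hj : j < W + 1), i ≤ j → l ⟨i, hi⟩ ≤ l ⟨j, hj⟩ :=
      fun i j hi hj h => hl.1 (by simpa using h)
    refine ⟨hm, ?_⟩
    simp only [stepAt, prevH] at hs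
    split_ifs at hs ⊢ with h
    · omega
    · have := hm (a - 1) a (by omega) (by omega) (by omega)
      omega
  refine Set.ncard_congr (fun l _ => (contra x a l : Fin W → ℕ)) ?_ ?_ ?_
  · rintro l ⟨hl, hle0, hs⟩
    have hle : ∀ c : Fin (W + 1), l c ≤ mu c := fun c => hle0 c
    obtain ⟨hm, hla⟩ := hstep l hl hs
    have hlx : ∀ i (hi : i < W + 1), a ≤ i → x ≤ l ⟨i, hi⟩ := fun i hi h => by
      have := hm a i (by omega) hi h
      omega
    refine ⟨⟨?_, ?_, ?_⟩, ?_⟩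
    · rintro ⟨i, hi⟩ ⟨j, hj⟩ hij
      have hij' : i ≤ j := hij
      simp only [contra]
      split_ifs with h1 h2
      · exact hm _ _ _ _ hij'
      · have e1 := hm i (a - 1) (by omega) (by omega) (by omega)
        have e2 := hm a (j + 1) (by omega) (by omega) (by omega)
        rw [dif_neg (by omega)] at hla
        omega
      · omega
      · have := hm (i + 1) (j + 1) (by omega) (by omega) (by omega)
        omega
    · rintro ⟨i, hi⟩
      simp only [contra]
      split_ifs with h1
      · have e1 := hm i (a - 1) (by omega) (by omega) (by omega)
        have e2 := hl.2.1 ⟨a, by omega⟩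
        rw [dif_neg (by omega)] at hla
        omega
      · have e2 := hl.2.1 ⟨i + 1, by omega⟩
        omega
    · intro h
      have e := hl.2.2 (by omega)
      simp only [contra]
      rw [if_neg (by omega)]
      have : W - 1 + 1 = W := by omega
      simp only [this]
      simp only [Nat.add_sub_cancel] at e
      rw [e]
    · rintro ⟨i, hi⟩
      change (contra x a l : Fin W → ℕ) ⟨i, hi⟩ ≤
        (contra x a (mu ⊓ eps W n a x qmax) : Fin W → ℕ) ⟨i, hi⟩
      simp only [contra, Pi.inf_apply, eps]
      split_ifs with h1 h2 h3
      · have e1 := hm i (a - 1) (by omega) (by omega) (by omega)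
        have e2 := hle ⟨a, by omega⟩
        have e3 := hle ⟨i, by omega⟩
        have e4 := hle ⟨a - 1, by omega⟩
        rw [dif_neg (by omega)] at hla
        rw [if_neg (by omega)] at hqmax
        simp only [prevH] at hqmax
        rw [dif_neg (by omega)] at hqmax
        simp only [le_inf_iff]
        omega
      · omega
      · omega
      · have e3 := hle ⟨i + 1, by omega⟩
        have e4 := hmun (i + 1) (by omega)
        rw [inf_eq_left.mpr e4]
        omega
  · rintro l l' ⟨hl, hle, hs⟩ ⟨hl', hle', hs'⟩ heq
    obtain ⟨hm, hla⟩ := hstep l hl hs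
    obtain ⟨hm', hla'⟩ := hstep l' hl' hs'
    have key1 : ∀ i (hi : i < W + 1), i < a → l ⟨i, hi⟩ = l' ⟨i, hi⟩ := by
      intro i hi h
      have := congrFun heq ⟨i, by omega⟩
      simpa [contra, h] using this
    funext ⟨c, hc⟩
    rcases lt_trichotomy c a with h | h | h
    · exact key1 c hc h
    · subst h
      rw [hla, hla']
      split_ifs with h0
      · rfl
      · rw [key1 _ _ (by omega)]
    · have := congrFun heq ⟨c - 1, by omega⟩
      simp only [contra] at this
      rw [if_neg (by omega), if_neg (by omega)] at this
      have hcc : c - 1 + 1 = c := by omega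
      simp only [hcc] at this
      have e1 := hm a c (by omega) hc (by omega)
      have e2 := hm' a c (by omega) hc (by omega)
      omega
  · rintro p ⟨hp, hple⟩
    have hm : ∀ i j (hi : i < W) (hj : j < W), i ≤ j → p ⟨i, hi⟩ ≤ p ⟨j, hj⟩ :=
      fun i j hi hj h => hp.1 (by simpa using h)
    have hpn : ∀ i (hi : i < W), p ⟨i, hi⟩ ≤ n - x := fun i hi => hp.2.1 _
    let l : Fin (W + 1) → ℕ := fun c =>
      if h : (c : ℕ) < a then p ⟨c, by omega⟩
      else if h0 : (c : ℕ) = 0 then x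
      else p ⟨(c : ℕ) - 1, by omega⟩ + x
    have l1 : ∀ c (hc : c < W + 1) (h : c < a), l ⟨c, hc⟩ = p ⟨c, by omega⟩ := by
      intro c hc h
      simp [l, h]
    have l2 : ∀ c (hc : c < W + 1) (h : ¬ c < a) (h0 : c = 0), l ⟨c, hc⟩ = x := by
      intro c hc h h0
      simp only [l]
      rw [dif_neg h, dif_pos h0]
    have l3 : ∀ c (hc : c < W + 1) (h : ¬ c < a) (h0 : c ≠ 0),
        l ⟨c, hc⟩ = p ⟨c - 1, by omega⟩ + x := by
      intro c hc h h0
      simp only [l]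
      rw [dif_neg h, dif_neg h0]
    have p1 : ∀ i (hi : i < W), i < a →
        p ⟨i, hi⟩ ≤ mu ⟨i, by omega⟩ ∧ p ⟨i, hi⟩ ≤ qmax := by
      intro i hi h
      have := hple ⟨i, hi⟩
      simp only [contra, Pi.inf_apply, eps, h, if_true, le_inf_iff] at this
      exact this
    have p2 : ∀ i (hi : i < W), a ≤ i → p ⟨i, hi⟩ + x ≤ mu ⟨i + 1, by omega⟩ := by
      intro i hi h
      have := hple ⟨i, hi⟩
      simp only [contra, Pi.inf_apply, eps] at this
      rw [if_neg (by omega), if_neg (by omega), if_neg (by omega),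
        inf_eq_left.mpr (hmun _ _)] at this
      have e := hmono a (i + 1) (by omega) (by omega) (by omega)
      omega
    refine ⟨l, ⟨⟨?_, ?_, ?_⟩, ?_, ?_⟩, ?_⟩
    · rintro ⟨i, hi⟩ ⟨j, hj⟩ hij
      have hij' : i ≤ j := hij
      by_cases h1 : i < a
      · rw [l1 i hi h1]
        by_cases h2 : j < a
        · rw [l1 j hj h2]
          exact hm _ _ _ _ hij'
        · rw [l3 j hj h2 (by omega)]
          have := hm i (j - 1) (by omega) (by omega) (by omega)
          omega
      · by_cases h0 : i = 0
        · rw [l2 i hi h1 h0]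
          by_cases h3 : j = 0
          · rw [l2 j hj (by omega) h3]
          · rw [l3 j hj (by omega) h3]
            omega
        · rw [l3 i hi h1 h0, l3 j hj (by omega) (by omega)]
          have := hm (i - 1) (j - 1) (by omega) (by omega) (by omega)
          omega
    · rintro ⟨i, hi⟩
      by_cases h1 : i < a
      · rw [l1 i hi h1]
        have := hpn i (by omega)
        omega
      · by_cases h0 : i = 0
        · rw [l2 i hi h1 h0]
          exact hx
        · rw [l3 i hi h1 h0]
          have := hpn (i - 1) (by omega)
          omega
    · intro h
      have e := hp.2.2 (by omega)
      simp only [Nat.add_sub_cancel]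
      rw [l3 W (by omega) (by omega) (by omega), e]
      omega
    · rintro ⟨i, hi⟩
      change l ⟨i, hi⟩ ≤ mu ⟨i, hi⟩
      by_cases h1 : i < a
      · rw [l1 i hi h1]
        exact (p1 i (by omega) h1).1
      · by_cases h0 : i = 0
        · rw [l2 i hi h1 h0]
          have e := hmono a i (by omega) (by omega) (by omega)
          omega
        · rw [l3 i hi h1 h0]
          by_cases h4 : i = a
          · subst h4
            have e := (p1 (i - 1) (by omega) (by omega)).2
            rw [if_neg h0] at hqmax
            have : qmax ≤ mu ⟨i, hi⟩ - x := hqmax ▸ min_le_right _ _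
            omega
          · have e := p2 (i - 1) (by omega) (by omega)
            have hcc : i - 1 + 1 = i := by omega
            simp only [hcc] at e
            exact e
    · simp only [stepAt, prevH]
      split_ifs with h0
      · rw [l2 a (by omega) (by omega) h0]
        omega
      · rw [l3 a (by omega) (by omega) h0, l1 (a - 1) (by omega) (by omega)]
        omega
    · funext ⟨i, hi⟩
      simp only [contra]
      split_ifs with h1
      · exact l1 i _ h1
      · rw [l3 (i + 1) (by omega) (by omega) (by omega)]
        simp
end
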